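/- arXiv:2509.15522 — 3 statements merged into one kernel-verified Lean document; each statement's English description precedes it below -/
import Mathlib

section
/- Let p be a prime number. Let H be a finite group containing a normal subgroup F with trivial center such that the quotient H/F is cyclic. Let α ∈ H be an element of order coprime to p, let B be the subgroup of H generated by F and α, and let γ be an element of B which commutes with every element of F. Then: (i) the order of γ is coprime to p; (ii) the cyclic subgroup A generated by γ satisfies σ(A) = A for every automorphism σ of H with σ(F) = F. -/
theorem mem_zpowers_of_orderOf_eq_aux {Q : Type*} [Group Q] [Finite Q] [IsCyclic Q] (x y : Q)
    (h : orderOf x = orderOf y) : y ∈ Subgroup.zpowers x := by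
  classical
  haveI := Fintype.ofFinite Q
  have h1 := IsCyclic.card_pow_eq_one_le (α := Q) (orderOf_pos x)
  have h2 : (Finset.univ.filter (fun z : Q => z ∈ Subgroup.zpowers x)) ⊆
      Finset.univ.filter (fun z : Q => z ^ orderOf x = 1) := by
    intro z hz
    simp only [Finset.mem_filter, Finset.mem_univ, true_and] at hz ⊢
    exact orderOf_dvd_iff_pow_eq_one.1 (orderOf_dvd_of_mem_zpowers hz)
  have h3 : (Finset.univ.filter (fun z : Q => z ∈ Subgroup.zpowers x)).card = orderOf x := by
    rw [← Fintype.card_subtype, ← Nat.card_eq_fintype_card]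
    exact Nat.card_zpowers x
  have h4 := Finset.eq_of_subset_of_card_le h2 (by rw [h3]; exact h1)
  have h5 : y ∈ Finset.univ.filter (fun z : Q => z ^ orderOf x = 1) := by
    simp [h, pow_orderOf_eq_one]
  rw [← h4] at h5
  simpa using h5

theorem stmt11 (p : ℕ) (hp : p.Prime)
    {H : Type*} [Group H] [Finite H] (F : Subgroup H) [F.Normal]
    (hZ : Subgroup.center ↥F = ⊥) (hcyc : IsCyclic (H ⧸ F))
    (α : H) (hα : Nat.Coprime (orderOf α) p)
    (B : Subgroup H) (hB : B = F ⊔ Subgroup.zpowers α)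
    (γ : H) (hγB : γ ∈ B) (hγF : ∀ x ∈ F, Commute γ x) :
    Nat.Coprime (orderOf γ) p ∧
    ∀ σ : MulAut H, Subgroup.map σ.toMonoidHom F = F →
      Subgroup.map σ.toMonoidHom (Subgroup.zpowers γ) = Subgroup.zpowers γ := by
  have key : ∀ c : H, (∀ x ∈ F, Commute c x) → c ∈ F → c = 1 := by
    intro c hc hcF
    have : (⟨c, hcF⟩ : F) ∈ Subgroup.center F := by
      rw [Subgroup.mem_center_iff]
      intro g
      exact Subtype.ext (hc g g.2).eq.symm
    rw [hZ, Subgroup.mem_bot] at this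
    exact congrArg Subtype.val this
  have hord : ∀ c : H, (∀ x ∈ F, Commute c x) →
      orderOf (QuotientGroup.mk' F c) = orderOf c := by
    intro c hc
    apply Nat.dvd_antisymm (orderOf_map_dvd _ c)
    apply orderOf_dvd_of_pow_eq_one
    apply key _ (fun x hx => (hc x hx).pow_left _)
    rw [← QuotientGroup.eq_one_iff]
    exact pow_orderOf_eq_one (QuotientGroup.mk' F c)
  constructor
  · have hle : B ≤ (Subgroup.zpowers (QuotientGroup.mk' F α)).comap (QuotientGroup.mk' F) := by
      rw [hB, sup_le_iff]
      constructor
      · intro x hx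
        have : QuotientGroup.mk' F x = 1 := (QuotientGroup.eq_one_iff x).2 hx
        rw [Subgroup.mem_comap, this]
        exact one_mem _
      · rw [Subgroup.zpowers_le]
        exact Subgroup.mem_zpowers _
    have h1 := orderOf_dvd_of_mem_zpowers (hle hγB)
    rw [hord γ hγF] at h1
    exact hα.coprime_dvd_left (h1.trans (orderOf_map_dvd _ α))
  · intro σ hσ
    have hs : ∀ x ∈ F, Commute (σ γ) x := by
      intro x hx
      rw [← hσ] at hx
      obtain ⟨y, hy, rfl⟩ := hx
      exact (hγF y hy).map σ
    have ho : orderOf (σ γ) = orderOf γ := MulEquiv.orderOf_eq σ γ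
    obtain ⟨k, hk⟩ := mem_zpowers_of_orderOf_eq_aux (QuotientGroup.mk' F γ)
      (QuotientGroup.mk' F (σ γ)) (by rw [hord _ hγF, hord _ hs, ho])
    have hk2 : σ γ = γ ^ k := by
      have := key ((γ ^ k)⁻¹ * σ γ)
        (fun x hx => (((hγF x hx).zpow_left k).inv_left).mul_left (hs x hx))
        (QuotientGroup.eq.1 hk)
      exact (inv_mul_eq_one.1 this).symm
    rw [MonoidHom.map_zpowers]
    apply Subgroup.eq_of_le_of_card_ge
    · rw [Subgroup.zpowers_le]
      exact ⟨k, hk2.symm⟩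
    · rw [Nat.card_zpowers, Nat.card_zpowers]
      exact ho.ge
end

section
/- Let p be a prime number and d a positive integer. Let H be a finite group containing a normal subgroup F with trivial center such that the quotient H/F is cyclic of order coprime to p. Suppose that for every automorphism σ of F there exists an integer r with 1 ≤ r ≤ d such that σ^r is an inner automorphism of F. Then H contains a cyclic subgroup A of order coprime to p and index at most d·|F| such that σ(A) = A for every automorphism σ of H with σ(F) = F. -/
theorem stmt12 (p : ℕ) (hp : p.Prime) (d : ℕ) (hd : 0 < d)
    {H : Type*} [Group H] [Finite H] (F : Subgroup H) [F.Normal]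
    (hZ : Subgroup.center ↥F = ⊥)
    (hcyc : IsCyclic (H ⧸ F)) (hcop : Nat.Coprime (Nat.card (H ⧸ F)) p)
    (hout : ∀ σ : MulAut ↥F, ∃ r : ℕ, 1 ≤ r ∧ r ≤ d ∧ ∃ f : ↥F, σ ^ r = MulAut.conj f) :
    ∃ A : Subgroup H, IsCyclic ↥A ∧ Nat.Coprime (Nat.card A) p ∧
      A.index ≤ d * Nat.card F ∧
      ∀ σ : MulAut H, Subgroup.map σ.toMonoidHom F = F →
        Subgroup.map σ.toMonoidHom A = A := by
  have hcomm : ∀ a : H, a ∈ Subgroup.centralizer (F : Set H) ↔ ∀ x ∈ F, x * a = a * x := by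
    intro a
    rw [Subgroup.mem_centralizer_iff]
    rfl
  let φ : ↥(Subgroup.centralizer (F : Set H)) →* H ⧸ F :=
    (QuotientGroup.mk' F).comp (Subgroup.centralizer (F : Set H)).subtype
  have hφ : Function.Injective φ := by
    rw [injective_iff_map_eq_one]
    rintro ⟨a, ha⟩ h1
    have haF : a ∈ F := (QuotientGroup.eq_one_iff a).1 h1
    have hc : (⟨a, haF⟩ : F) ∈ Subgroup.center ↥F := by
      rw [Subgroup.mem_center_iff]
      intro g
      exact Subtype.ext ((hcomm a).1 ha g g.2)
    rw [hZ, Subgroup.mem_bot] at hc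
    have ha1 : a = 1 := congrArg (fun x : F => (x : H)) hc
    exact Subtype.ext ha1
  refine ⟨Subgroup.centralizer (F : Set H), isCyclic_of_injective φ hφ, ?_, ?_, ?_⟩
  · exact Nat.Coprime.coprime_dvd_left (Subgroup.card_dvd_of_injective φ hφ) hcop
  · obtain ⟨g, hg⟩ := hcyc.exists_generator
    obtain ⟨h, rfl⟩ := QuotientGroup.mk_surjective g
    obtain ⟨r, hr1, hrd, f, hf⟩ := hout (MulAut.conjNormal h)
    rw [← map_pow] at hf
    have ha : (f : H)⁻¹ * h ^ r ∈ Subgroup.centralizer (F : Set H) := by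
      rw [hcomm]
      intro x hx
      have h2 := congrArg (fun s : MulAut ↥F => ((s ⟨x, hx⟩ : F) : H)) hf
      simp only [MulAut.conjNormal_apply, MulAut.conj_apply, Subgroup.coe_mul,
        Subgroup.coe_inv] at h2
      have h3 : h ^ r * x = f * x * (f : H)⁻¹ * h ^ r := by rw [← h2]; group
      rw [mul_assoc, h3]
      group
    have hord : orderOf (h : H ⧸ F) = Nat.card (H ⧸ F) :=
      orderOf_eq_card_of_forall_mem_zpowers hg
    have himg : φ ⟨_, ha⟩ = (h : H ⧸ F) ^ r := by
      change (((f : H)⁻¹ * h ^ r : H) : H ⧸ F) = _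
      have : ((f : H) : H ⧸ F) = 1 := (QuotientGroup.eq_one_iff _).2 f.2
      simp [this]
    have h4 : ((h : H ⧸ F) ^ r) ^ Nat.card (Subgroup.centralizer (F : Set H)) = 1 := by
      rw [← himg, ← map_pow, pow_card_eq_one', map_one]
    rw [← pow_mul] at h4
    have h5 : Nat.card (H ⧸ F) ≤ r * Nat.card (Subgroup.centralizer (F : Set H)) := by
      rw [← hord]
      exact Nat.le_of_dvd (Nat.mul_pos hr1 Nat.card_pos) (orderOf_dvd_of_pow_eq_one h4)
    have h6 := Subgroup.index_mul_card (Subgroup.centralizer (F : Set H))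
    have h7 := Subgroup.card_eq_card_quotient_mul_card_subgroup F
    refine Nat.le_of_mul_le_mul_right ?_
      (Nat.card_pos (α := ↥(Subgroup.centralizer (F : Set H))))
    rw [h6, h7]
    calc _ ≤ (r * Nat.card (Subgroup.centralizer (F : Set H))) * Nat.card F := by gcongr
      _ ≤ (d * Nat.card (Subgroup.centralizer (F : Set H))) * Nat.card F := by gcongr
      _ = _ := by ring
  · intro σ hσ
    have hle : Subgroup.map σ.toMonoidHom (Subgroup.centralizer (F : Set H)) ≤
        Subgroup.centralizer (F : Set H) := by
      rintro _ ⟨a, ha, rfl⟩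
      rw [hcomm]
      intro x hx
      rw [← hσ] at hx
      obtain ⟨y, hy, rfl⟩ := hx
      rw [← map_mul, ← map_mul, (hcomm a).1 ha y hy]
    refine Subgroup.eq_of_le_of_card_ge hle ?_
    exact (Nat.card_congr
      (Subgroup.equivMapOfInjective _ σ.toMonoidHom σ.injective).toEquiv).le
end

section
/- Let p be a prime number. Let H be a finite group containing a normal subgroup F isomorphic to one of the groups A_4 (alternating group of degree 4), S_4 (symmetric group of degree 4), or A_5 (alternating group of degree 5), such that the quotient H/F is cyclic of order coprime to p. Then H contains a cyclic subgroup A of order coprime to p and index at most J·|F_(p)|^3, where J = 120 if p ≥ 7, J = 48 if p = 5, J = 40/9 if p = 3, and J = 2 if p = 2, such that σ(A) = A for every automorphism σ of H with σ(F) = F. -/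
/-- `sylowCard p G` is the order of a `p`-Sylow subgroup of the finite group `G`,
i.e. the largest power of `p` dividing `|G|`. -/
noncomputable def sylowCard (p : ℕ) (G : Type*) [Group G] : ℕ := p ^ (Nat.card G).factorization p

set_option maxRecDepth 100000

namespace Stmt13Aux

/-- The generators used: a 3-cycle, a double transposition, a 4-cycle in degree 4;
a 5-cycle and a double transposition in degree 5. -/
abbrev x4 : Equiv.Perm (Fin 4) := c[0,1,2]
abbrev y4 : Equiv.Perm (Fin 4) := c[0,1]*c[2,3]
abbrev z4 : Equiv.Perm (Fin 4) := c[0,1,2,3]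
abbrev x5 : Equiv.Perm (Fin 5) := c[0,1,2,3,4]
abbrev y5 : Equiv.Perm (Fin 5) := c[0,1]*c[2,3]

theorem a4 : (Finset.univ.filter fun q : Equiv.Perm (Fin 4) => q ≠ 1 ∧ q^3=1).card ≤ 8 := by
  decide +kernel
theorem a5 : (Finset.univ.filter fun q : Equiv.Perm (Fin 4) => q^2 ≠ 1 ∧ q^4=1).card ≤ 6 := by
  decide +kernel
theorem a6 : (Finset.univ.filter fun q : Equiv.Perm (Fin 4) =>
    q ≠ 1 ∧ q^2=1 ∧ Equiv.Perm.sign q = 1).card ≤ 6 := by decide +kernel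
theorem a7 : (Finset.univ.filter fun q : Equiv.Perm (Fin 5) => q ≠ 1 ∧ q^5=1).card ≤ 24 := by
  decide +kernel
theorem a8 : (Finset.univ.filter fun q : Equiv.Perm (Fin 5) =>
    q ≠ 1 ∧ q^2=1 ∧ (x5 * q)^3=1).card ≤ 5 := by decide +kernel
theorem b1 : ∀ z : Equiv.Perm (Fin 4), z * x4 = x4*z → z*y4 = y4 * z → z = 1 := by decide +kernel
theorem b2 : ∀ z : Equiv.Perm (Fin 4), z * x4 = x4*z → z*z4 = z4 * z → z = 1 := by decide +kernel
theorem b3 : ∀ z : Equiv.Perm (Fin 5), z * x5 = x5*z → z*y5 = y5 * z → z = 1 := by decide +kernel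
theorem c1 : ∀ g : Equiv.Perm (Fin 4), Equiv.Perm.sign g = 1 →
    ∃ i < 3, ∃ j < 2, ∃ k < 3, ∃ l < 2, g = x4^i * y4^j * x4^k * y4^l := by decide +kernel
theorem c2 : ∀ g : Equiv.Perm (Fin 4),
    ∃ i < 4, ∃ j < 3, ∃ k < 4, ∃ l < 3, g = z4^i * x4^j * z4^k *x4^l:= by decide +kernel

/-- The pairs `(a, b)` of permutations of degree 5 satisfying the `(2,3,5)` relations. -/
theorem pairs5 : (Finset.univ.filter fun q : Equiv.Perm (Fin 5) × Equiv.Perm (Fin 5) =>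
    (q.1 ≠ 1 ∧ q.1^5=1) ∧ q.2 ≠ 1 ∧ q.2^2=1 ∧ (q.1 * q.2)^3=1).card ≤ 120 := by
  have h := Finset.card_le_mul_card_image_of_maps_to
    (s := (Finset.univ.filter fun q : Equiv.Perm (Fin 5) × Equiv.Perm (Fin 5) =>
      (q.1 ≠ 1 ∧ q.1^5=1) ∧ q.2 ≠ 1 ∧ q.2^2=1 ∧ (q.1 * q.2)^3=1))
    (t := Finset.univ.filter fun q : Equiv.Perm (Fin 5) => q ≠ 1 ∧ q^5=1)
    (f := Prod.fst) (by
      intro q hq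
      simp only [Finset.mem_filter, Finset.mem_univ, true_and] at hq ⊢
      exact hq.1) 5 (by
      intro a ha
      simp only [Finset.mem_filter, Finset.mem_univ, true_and] at ha
      have hconj : IsConj x5 a := by
        rw [Equiv.Perm.isConj_iff_cycleType_eq]
        have key : ∀ b : Equiv.Perm (Fin 5), b ≠ 1 → b ^ 5 = 1 → b.cycleType = {5} := by
          intro b hb hb5
          have : Fact (Nat.Prime 5) := ⟨by norm_num⟩
          have ho : orderOf b = 5 := orderOf_eq_prime hb5 hb
          obtain ⟨n, hn⟩ := Equiv.Perm.cycleType_prime_order (σ := b) (by rw [ho]; norm_num)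
          have hs := Equiv.Perm.sum_cycleType b
          have hle := b.support.card_le_univ
          rw [hn, ho] at hs
          simp at hs hle
          have : n = 0 := by omega
          rw [hn, ho, this]; rfl
        rw [key a ha.1 ha.2, key x5 (by decide +kernel) (by decide +kernel)]
      obtain ⟨g, hg⟩ := isConj_iff.1 hconj
      refine le_trans (Finset.card_le_card_of_injOn (fun q => g⁻¹ * q.2 * g) ?_ ?_) a8
      · intro q hq
        simp only [Finset.coe_filter, Finset.mem_filter, Finset.mem_univ, true_and,
          Set.mem_ofPred_eq] at hq ⊢
        obtain ⟨⟨_, h1, h2, h3⟩, h4⟩ := hq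
        refine ⟨?_, ?_, ?_⟩
        · intro h
          apply h1
          have : q.2 = g * (g⁻¹ * q.2 * g) * g⁻¹ := by group
          rw [this, h]; group
        · have : (g⁻¹ * q.2 * g)^2 = g⁻¹ * q.2^2 * g := by
            simp only [pow_two]; group
          rw [this, h2]; group
        · have e : x5 * (g⁻¹ * q.2 * g) = g⁻¹ * (q.1 * q.2) * g := by
            rw [h4, ← hg]; group
          have : (g⁻¹ * (q.1 * q.2) * g)^3 = g⁻¹ * (q.1 * q.2)^3 * g := by
            simp only [pow_succ, pow_zero]; group
          rw [e, this, h3]; group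
      · intro q hq r hr hqr
        simp only [Finset.coe_filter, Finset.mem_filter, Finset.mem_univ, true_and,
          Set.mem_ofPred_eq] at hq hr hqr
        refine Prod.ext (hq.2.trans hr.2.symm) ?_
        simpa using hqr)
  exact h.trans (by have := a7; omega)

/-- The property of `F` that is used. -/
def Good (G : Type*) [Group G] (B : ℕ) : Prop :=
  (∀ z : G, (∀ g : G, z * g = g * z) → z = 1) ∧ Nat.card (MulAut G) ≤ B

theorem Good.of_equiv {G K : Type*} [Group G] [Group K] (e : G ≃* K) {B : ℕ} (h : Good K B) :
    Good G B := by
  refine ⟨fun z hz => ?_, ?_⟩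
  · apply e.injective
    rw [map_one]
    refine h.1 _ fun g => ?_
    obtain ⟨g, rfl⟩ := e.surjective g
    rw [← map_mul, hz, map_mul]
  · rw [Nat.card_congr (MulAut.congr e).toEquiv]
    exact h.2

/-- Automorphisms agreeing on generators are equal, so we may count images of generators. -/
theorem card_aut_le {G P : Type*} [Group G] (x y : G) (hxy : Subgroup.closure {x, y} = ⊤)
    (f : G → P) (hf : Function.Injective f) (S : Finset (P × P))
    (hS : ∀ φ : MulAut G, (f (φ x), f (φ y)) ∈ S) : Nat.card (MulAut G) ≤ S.card := by
  have hinj : Function.Injective (fun φ : MulAut G => (⟨(f (φ x), f (φ y)), hS φ⟩ : S)) := by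
    intro φ ψ h
    simp only [Subtype.mk.injEq, Prod.mk.injEq] at h
    have : (φ.toMonoidHom : G →* G) = ψ.toMonoidHom := by
      refine MonoidHom.eq_of_eqOn_dense hxy ?_
      rintro z (rfl | rfl)
      · exact hf h.1
      · exact hf h.2
    ext g
    exact DFunLike.congr_fun this g
  have := Nat.card_le_card_of_injective _ hinj
  simpa using this

theorem good_S4 : Good (Equiv.Perm (Fin 4)) 48 := by
  refine ⟨fun z hz => b2 z (hz _) (hz _), ?_⟩
  refine (card_aut_le z4 x4 ?_ id Function.injective_id
    ((Finset.univ.filter fun q : Equiv.Perm (Fin 4) => q^2 ≠ 1 ∧ q^4=1) ×ˢ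
      (Finset.univ.filter fun q : Equiv.Perm (Fin 4) => q ≠ 1 ∧ q^3=1)) ?_).trans ?_
  · rw [eq_top_iff]
    intro g _
    obtain ⟨i, _, j, _, k, _, l, _, rfl⟩ := c2 g
    have h1 : z4 ∈ Subgroup.closure {z4, x4} := Subgroup.subset_closure (by simp)
    have h2 : x4 ∈ Subgroup.closure {z4, x4} := Subgroup.subset_closure (by simp)
    exact mul_mem (mul_mem (mul_mem (pow_mem h1 _) (pow_mem h2 _)) (pow_mem h1 _)) (pow_mem h2 _)
  · intro φ
    simp only [Finset.mem_product, Finset.mem_filter, Finset.mem_univ, true_and, id]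
    simp only [← map_pow, ne_eq, EmbeddingLike.map_eq_one_iff]
    decide +kernel
  · rw [Finset.card_product]
    exact Nat.mul_le_mul a5 a4

abbrev X4 : alternatingGroup (Fin 4) := ⟨x4, by rw [Equiv.Perm.mem_alternatingGroup]; decide⟩
abbrev Y4 : alternatingGroup (Fin 4) := ⟨y4, by rw [Equiv.Perm.mem_alternatingGroup]; decide⟩
abbrev X5 : alternatingGroup (Fin 5) := ⟨x5, by rw [Equiv.Perm.mem_alternatingGroup]; decide⟩
abbrev Y5 : alternatingGroup (Fin 5) := ⟨y5, by rw [Equiv.Perm.mem_alternatingGroup]; decide⟩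

theorem good_A4 : Good (alternatingGroup (Fin 4)) 48 := by
  refine ⟨fun z hz => Subtype.ext (b1 z (congrArg Subtype.val (hz X4))
    (congrArg Subtype.val (hz Y4))), ?_⟩
  refine (card_aut_le X4 Y4 ?_ Subtype.val Subtype.val_injective
    ((Finset.univ.filter fun q : Equiv.Perm (Fin 4) => q ≠ 1 ∧ q^3=1) ×ˢ
      (Finset.univ.filter fun q : Equiv.Perm (Fin 4) =>
        q ≠ 1 ∧ q^2=1 ∧ Equiv.Perm.sign q = 1)) ?_).trans ?_
  · rw [eq_top_iff]
    intro g _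
    obtain ⟨i, _, j, _, k, _, l, _, hg⟩ := c1 g (Equiv.Perm.mem_alternatingGroup.1 g.2)
    have h1 : X4 ∈ Subgroup.closure {X4, Y4} := Subgroup.subset_closure (by simp)
    have h2 : Y4 ∈ Subgroup.closure {X4, Y4} := Subgroup.subset_closure (by simp)
    have : g = X4^i * Y4^j * X4^k * Y4^l := Subtype.ext hg
    rw [this]
    exact mul_mem (mul_mem (mul_mem (pow_mem h1 _) (pow_mem h2 _)) (pow_mem h1 _)) (pow_mem h2 _)
  · intro φ
    have hs := Equiv.Perm.mem_alternatingGroup.1 (φ Y4).2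
    simp only [Finset.mem_product, Finset.mem_filter, Finset.mem_univ, true_and, hs, and_true]
    simp only [← Subgroup.coe_pow, ← map_pow, ne_eq, OneMemClass.coe_eq_one,
      EmbeddingLike.map_eq_one_iff]
    simp only [Subtype.ext_iff, Subgroup.coe_pow, Subgroup.coe_one]
    decide +kernel
  · rw [Finset.card_product]
    exact Nat.mul_le_mul a4 a6

theorem gen5 : Subgroup.closure {X5, Y5} = ⊤ := by
  set K := Subgroup.closure {X5, Y5} with hK
  have h1 : X5 ∈ K := Subgroup.subset_closure (by simp)
  have h2 : Y5 ∈ K := Subgroup.subset_closure (by simp)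
  have h3 : X5 * Y5 ∈ K := mul_mem h1 h2
  have hX1 : X5 ≠ 1 := by
    rw [Ne, Subtype.ext_iff, Subgroup.coe_one]; decide +kernel
  have o5 : orderOf X5 = 5 := by
    have : Fact (Nat.Prime 5) := ⟨by norm_num⟩
    refine orderOf_eq_prime ?_ hX1
    rw [Subtype.ext_iff, Subgroup.coe_pow, Subgroup.coe_one]; decide +kernel
  have o2 : orderOf Y5 = 2 := by
    refine orderOf_eq_prime ?_ ?_
    · rw [Subtype.ext_iff, Subgroup.coe_pow, Subgroup.coe_one]; decide +kernel
    · rw [Ne, Subtype.ext_iff, Subgroup.coe_one]; decide +kernel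
  have o3 : orderOf (X5 * Y5) = 3 := by
    refine orderOf_eq_prime ?_ ?_
    · rw [Subtype.ext_iff, Subgroup.coe_pow, Subgroup.coe_one, Subgroup.coe_mul]; decide +kernel
    · rw [Ne, Subtype.ext_iff, Subgroup.coe_one, Subgroup.coe_mul]; decide +kernel
  have d5 : 5 ∣ Nat.card K := by
    have := K.orderOf_dvd_natCard h1
    rwa [o5] at this
  have d2 : 2 ∣ Nat.card K := by
    have := K.orderOf_dvd_natCard h2
    rwa [o2] at this
  have d3 : 3 ∣ Nat.card K := by
    have := K.orderOf_dvd_natCard h3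
    rwa [o3] at this
  have hc : Nat.card K * K.index = 60 := by
    rw [K.card_mul_index, nat_card_alternatingGroup]; simp; rfl
  have hn : K.Normal := by
    have d30 : 30 ∣ Nat.card K := by omega
    obtain ⟨m, hm⟩ := d30
    rw [hm] at hc
    have hmi : m * K.index = 2 := by
      have : 30 * (m * K.index) = 30 * 2 := by rw [← mul_assoc]; exact hc
      omega
    have hd : K.index ∣ 2 := Dvd.intro_left _ hmi
    rcases (Nat.dvd_prime Nat.prime_two).1 hd with h | h
    · rw [Subgroup.index_eq_one] at h
      rw [h]; infer_instance
    · exact Subgroup.normal_of_index_eq_two h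
  have := alternatingGroup.isSimpleGroup_five
  rcases hn.eq_bot_or_eq_top with h | h
  · exfalso
    rw [h, Subgroup.mem_bot] at h1
    exact hX1 h1
  · exact h

theorem good_A5 : Good (alternatingGroup (Fin 5)) 120 := by
  refine ⟨fun z hz => Subtype.ext (b3 z (congrArg Subtype.val (hz X5))
    (congrArg Subtype.val (hz Y5))), ?_⟩
  refine (card_aut_le X5 Y5 gen5 Subtype.val Subtype.val_injective _ ?_).trans pairs5
  intro φ
  simp only [Finset.mem_filter, Finset.mem_univ, true_and]
  simp only [← Subgroup.coe_mul, ← Subgroup.coe_pow, ← map_mul, ← map_pow, ne_eq,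
    OneMemClass.coe_eq_one, EmbeddingLike.map_eq_one_iff]
  simp only [Subtype.ext_iff, Subgroup.coe_pow, Subgroup.coe_mul, Subgroup.coe_one]
  decide +kernel

/-- The centralizer of `F` does the job. -/
theorem main {H : Type*} [Group H] [Finite H] (F : Subgroup H) [F.Normal] (p B : ℕ)
    (hG : Good F B) (hcyc : IsCyclic (H ⧸ F)) (hcop : Nat.Coprime (Nat.card (H ⧸ F)) p) :
    ∃ A : Subgroup H, IsCyclic ↥A ∧ Nat.Coprime (Nat.card A) p ∧ A.index ≤ B ∧
      ∀ σ : MulAut H, Subgroup.map σ.toMonoidHom F = F →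
        Subgroup.map σ.toMonoidHom A = A := by
  set C := Subgroup.centralizer (F : Set H) with hC
  let f : C →* H ⧸ F := (QuotientGroup.mk' F).comp C.subtype
  have hf : Function.Injective f := by
    rw [injective_iff_map_eq_one]
    intro a ha
    have haF : (a : H) ∈ F := (QuotientGroup.eq_one_iff (a : H)).1 ha
    have := hG.1 ⟨a, haF⟩ fun g => Subtype.ext
      (Subgroup.mem_centralizer_iff.1 a.2 g g.2).symm
    have h' : (a : H) = 1 := congrArg Subtype.val this
    exact Subtype.ext h'
  refine ⟨C, isCyclic_of_injective f hf,
    Nat.Coprime.coprime_dvd_left (Subgroup.card_dvd_of_injective f hf) hcop, ?_, ?_⟩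
  · have hk : C = (MulAut.conjNormal (H := F)).ker := by
      ext g
      rw [MonoidHom.mem_ker, Subgroup.mem_centralizer_iff]
      constructor
      · intro h
        ext a
        rw [MulAut.conjNormal_apply, ← h a a.2]
        simp
      · intro h a ha
        have := congrArg Subtype.val (DFunLike.congr_fun h ⟨a, ha⟩)
        rw [MulAut.conjNormal_apply] at this
        simp only [MulAut.one_apply] at this
        exact (mul_inv_eq_iff_eq_mul.1 this).symm
    rw [hk, Subgroup.index_ker]
    refine le_trans ?_ hG.2
    exact Nat.card_le_card_of_injective _ Subtype.val_injective
  · have key : ∀ σ : MulAut H, Subgroup.map σ.toMonoidHom F = F →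
        Subgroup.map σ.toMonoidHom C ≤ C := by
      rintro σ hσ _ ⟨c, hc, rfl⟩
      rw [Subgroup.mem_centralizer_iff]
      intro h hh
      have hh' : h ∈ Subgroup.map σ.toMonoidHom F := by rw [hσ]; exact hh
      obtain ⟨k, hk, rfl⟩ := hh'
      rw [← map_mul, ← map_mul, Subgroup.mem_centralizer_iff.1 hc k hk]
    intro σ hσ
    refine Subgroup.eq_of_le_of_card_ge (key σ hσ) ?_
    rw [Subgroup.card_map_of_injective σ.injective]

end Stmt13Aux

theorem stmt13 (p : ℕ) (hp : p.Prime)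
    {H : Type*} [Group H] [Finite H] (F : Subgroup H) [F.Normal]
    (hF : Nonempty (↥F ≃* ↥(alternatingGroup (Fin 4))) ∨
          Nonempty (↥F ≃* Equiv.Perm (Fin 4)) ∨
          Nonempty (↥F ≃* ↥(alternatingGroup (Fin 5))))
    (hcyc : IsCyclic (H ⧸ F)) (hcop : Nat.Coprime (Nat.card (H ⧸ F)) p) :
    ∃ A : Subgroup H, IsCyclic ↥A ∧ Nat.Coprime (Nat.card A) p ∧
      (A.index : ℝ) ≤
        (if 7 ≤ p then (120 : ℝ) else if p = 5 then 48 else if p = 3 then 40 / 9 else 2) *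
          (sylowCard p ↥F : ℝ) ^ 3 ∧
      ∀ σ : MulAut H, Subgroup.map σ.toMonoidHom F = F →
        Subgroup.map σ.toMonoidHom A = A := by
  have hpow : (1 : ℝ) ≤ (sylowCard p ↥F : ℝ) ^ 3 := by
    apply one_le_pow₀
    unfold sylowCard
    exact_mod_cast Nat.one_le_pow _ _ hp.pos
  have hsyl : ∀ k : ℕ, p ^ k ∣ Nat.card F → ((p ^ k : ℕ) : ℝ) ^ 3 ≤ (sylowCard p ↥F : ℝ) ^ 3 := by
    intro k hk
    have h1 : k ≤ (Nat.card F).factorization p :=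
      (hp.pow_dvd_iff_le_factorization Nat.card_pos.ne').1 hk
    have h2 : p ^ k ≤ sylowCard p F := Nat.pow_le_pow_right hp.pos h1
    gcongr
  obtain ⟨B, hG, hB⟩ : ∃ B : ℕ, Stmt13Aux.Good F B ∧
      (B = 48 ∧ 12 ∣ Nat.card F ∨ B = 120 ∧ 60 ∣ Nat.card F) := by
    rcases hF with ⟨⟨e⟩⟩ | ⟨⟨e⟩⟩ | ⟨⟨e⟩⟩
    · refine ⟨48, Stmt13Aux.good_A4.of_equiv e, Or.inl ⟨rfl, ?_⟩⟩
      rw [Nat.card_congr e.toEquiv, nat_card_alternatingGroup]; simp; decide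
    · refine ⟨48, Stmt13Aux.good_S4.of_equiv e, Or.inl ⟨rfl, ?_⟩⟩
      rw [Nat.card_congr e.toEquiv, Nat.card_perm]; simp; decide
    · refine ⟨120, Stmt13Aux.good_A5.of_equiv e, Or.inr ⟨rfl, ?_⟩⟩
      rw [Nat.card_congr e.toEquiv, nat_card_alternatingGroup]; simp; decide
  obtain ⟨A, h1, h2, h3, h4⟩ := Stmt13Aux.main F p B hG hcyc hcop
  refine ⟨A, h1, h2, ?_, h4⟩
  have h3' : (A.index : ℝ) ≤ B := by exact_mod_cast h3
  refine h3'.trans ?_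
  have hB120 : (B : ℝ) ≤ 120 := by
    rcases hB with ⟨rfl, _⟩ | ⟨rfl, _⟩ <;> norm_num
  have h12 : 12 ∣ Nat.card F := by
    rcases hB with ⟨_, h⟩ | ⟨_, h⟩
    · exact h
    · exact dvd_trans (by norm_num) h
  split_ifs with c7 c5 c3
  · linarith
  · subst c5
    rcases hB with ⟨rfl, _⟩ | ⟨rfl, h⟩
    · push_cast; linarith
    · have := hsyl 1 (dvd_trans (by norm_num) h)
      norm_num at this ⊢
      linarith
  · subst c3
    have := hsyl 1 (dvd_trans (by norm_num) h12)
    norm_num at this ⊢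
    linarith
  · have hp2 : p = 2 := by
      have : p < 7 := by omega
      interval_cases p <;> first | rfl | omega | (exfalso; revert hp; norm_num)
    subst hp2
    have := hsyl 2 (dvd_trans (by norm_num) h12)
    norm_num at this ⊢
    linarith
end
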